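/- Let N ≥ 1, let J be a set function on the Lebesgue-measurable subsets of ℝ^N with values in [0, +∞], let E ⊆ ℝ^N be nonempty and bounded, and let h > 0. For measurable F set 𝓔(F) := J(F) + (1/h)∫_F d_E dx, and for u ∈ L^∞(ℝ^N) with 0 ≤ u ≤ 1 set 𝓔̄(u) := ∫₀¹ J({u > s}) ds + (1/h)∫_{ℝ^N} u(x) d_E(x) dx, assuming that s ↦ J({u > s}) is Lebesgue measurable on (0,1). If u minimizes 𝓔̄ over all measurable functions with values in [0,1] (with measurable level-set profile), then for Lebesgue-almost every s ∈ (0, 1) the superlevel set {u > s} minimizes 𝓔 over Lebesgue-measurable sets. -/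

import Mathlib

open MeasureTheory Filter Set
open scoped ENNReal

noncomputable def sdist {N : ℕ} (E : Set (EuclideanSpace ℝ (Fin N)))
    (x : EuclideanSpace ℝ (Fin N)) : ℝ :=
  Metric.infDist x E - Metric.infDist x Eᶜ

noncomputable def enInt {N : ℕ} (f : EuclideanSpace ℝ (Fin N) → ℝ)
    (F : Set (EuclideanSpace ℝ (Fin N))) : EReal :=
  ((∫⁻ x in F, ENNReal.ofReal (f x) ∂volume : ℝ≥0∞) : EReal) -
    ((∫⁻ x in F, ENNReal.ofReal (-f x) ∂volume : ℝ≥0∞) : EReal)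

/-- The incremental energy `𝓔(F) = J(F) + (1/h)∫_F d_E dx` on sets. -/
noncomputable def eneSet {N : ℕ} (J : Set (EuclideanSpace ℝ (Fin N)) → ℝ≥0∞)
    (E : Set (EuclideanSpace ℝ (Fin N))) (h : ℝ)
    (F : Set (EuclideanSpace ℝ (Fin N))) : EReal :=
  (J F : EReal) + enInt (fun x => sdist E x / h) F

/-- The extension `𝓔̄(u) = ∫₀¹ J({u > s}) ds + (1/h)∫ u d_E dx` of the incremental energy
to `[0,1]`-valued functions, via the generalized coarea formula. -/
noncomputable def eneFun {N : ℕ} (J : Set (EuclideanSpace ℝ (Fin N)) → ℝ≥0∞)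
    (E : Set (EuclideanSpace ℝ (Fin N))) (h : ℝ)
    (u : EuclideanSpace ℝ (Fin N) → ℝ) : EReal :=
  ((∫⁻ s in Set.Ioo (0:ℝ) 1, J {x | s < u x} ∂volume : ℝ≥0∞) : EReal) +
    enInt (fun x => u x * sdist E x / h) Set.univ

/-- Tonelli's theorem for the sections of a measurable set in a product. -/
theorem lintegral_setLIntegral_section {X : Type*} [MeasurableSpace X] {μ : Measure X}
    [SFinite μ] {S : Set (ℝ × X)} (hS : MeasurableSet S) {g : X → ℝ≥0∞} (hg : Measurable g) :
    ∫⁻ s in Ioo (0 : ℝ) 1, ∫⁻ x in {x | (s, x) ∈ S}, g x ∂μ =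
      ∫⁻ x, volume ({s | (s, x) ∈ S} ∩ Ioo (0 : ℝ) 1) * g x ∂μ := by
  have hmeas : Measurable (S.indicator fun p : ℝ × X => g p.2) :=
    (hg.comp measurable_snd).indicator hS
  calc
    ∫⁻ s in Ioo (0 : ℝ) 1, ∫⁻ x in {x | (s, x) ∈ S}, g x ∂μ
    _ = ∫⁻ s in Ioo (0 : ℝ) 1, ∫⁻ x, S.indicator (fun p : ℝ × X => g p.2) (s, x) ∂μ := by
      refine lintegral_congr fun s => ?_
      have hs : MeasurableSet {x : X | (s, x) ∈ S} := measurable_prodMk_left hS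
      rw [← lintegral_indicator hs]
      rfl
    _ = ∫⁻ x, (∫⁻ s in Ioo (0 : ℝ) 1, S.indicator (fun p : ℝ × X => g p.2) (s, x)) ∂μ :=
      lintegral_lintegral_swap hmeas.aemeasurable
    _ = _ := by
      refine lintegral_congr fun x => ?_
      have hx : MeasurableSet {s : ℝ | (s, x) ∈ S} := measurable_prodMk_right hS
      have : (fun s : ℝ => S.indicator (fun p : ℝ × X => g p.2) (s, x)) =
          {s : ℝ | (s, x) ∈ S}.indicator fun _ => g x := rfl
      rw [this, lintegral_indicator_const hx, Measure.restrict_apply hx, mul_comm]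

theorem measurable_setLIntegral_section {X : Type*} [MeasurableSpace X] {μ : Measure X}
    [SFinite μ] {S : Set (ℝ × X)} (hS : MeasurableSet S) {g : X → ℝ≥0∞} (hg : Measurable g) :
    Measurable fun s : ℝ => ∫⁻ x in {x | (s, x) ∈ S}, g x ∂μ := by
  have hmeas : Measurable (S.indicator fun p : ℝ × X => g p.2) :=
    (hg.comp measurable_snd).indicator hS
  convert hmeas.lintegral_prod_right' (ν := μ) using 2 with s
  have hs : MeasurableSet {x : X | (s, x) ∈ S} := measurable_prodMk_left hS
  rw [← lintegral_indicator hs]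
  rfl

theorem volume_setOf_lt_inter_Ioo {t : ℝ} (ht : t ∈ Icc (0 : ℝ) 1) :
    volume ({s | s < t} ∩ Ioo (0 : ℝ) 1) = ENNReal.ofReal t := by
  have : {s | s < t} ∩ Ioo (0 : ℝ) 1 = Ioo 0 t := by
    ext s
    simp only [mem_inter_iff, mem_ofPred_eq, mem_Ioo]
    exact ⟨fun hs => ⟨hs.2.1, hs.1⟩, fun hs => ⟨hs.2, hs.1, hs.2.trans_le ht.2⟩⟩
  rw [this, Real.volume_Ioo, sub_zero]

theorem volume_setOf_le_inter_Ioo {t : ℝ} (ht : t ∈ Icc (0 : ℝ) 1) :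
    volume ({s | t ≤ s} ∩ Ioo (0 : ℝ) 1) = ENNReal.ofReal (1 - t) := by
  apply le_antisymm
  · rw [← Real.volume_Ico]
    exact measure_mono fun s hs => ⟨hs.1, hs.2.2⟩
  · rw [← Real.volume_Ioo]
    exact measure_mono fun s hs => ⟨hs.1.le, ht.1.trans_lt hs.1, hs.2⟩

theorem ereal_add_sub_eq_sub {a p q r M : ℝ≥0∞} (hM : M ≠ ∞) (hqr : q + r = M) :
    (a : EReal) + ((p : EReal) - (q : EReal)) = ((a + (p + r) : ℝ≥0∞) : EReal) - (M : EReal) := by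
  subst hqr
  obtain ⟨hq, hr⟩ := ENNReal.add_ne_top.1 hM
  lift q to NNReal using hq
  lift r to NNReal using hr
  have hp : (p : EReal) - ((q : ℝ≥0∞) : EReal) =
      ((p + r : ℝ≥0∞) : EReal) - ((q + r : ℝ≥0∞) : EReal) := by
    induction p with
    | top => rfl
    | coe p =>
      simp only [← ENNReal.coe_add, EReal.coe_nnreal_eq_coe_real, ← EReal.coe_sub,
        NNReal.coe_add, add_sub_add_right_eq_sub]
  rw [hp, sub_eq_add_neg, sub_eq_add_neg, ← add_assoc, ← EReal.coe_ennreal_add]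

theorem ereal_sub_le_sub_iff {x y M : ℝ≥0∞} (hM : M ≠ ∞) :
    (x : EReal) - (M : EReal) ≤ (y : EReal) - (M : EReal) ↔ x ≤ y := by
  refine ⟨fun hxy => ?_, fun hxy => EReal.sub_le_sub (by exact_mod_cast hxy) le_rfl⟩
  lift M to NNReal using hM
  induction y with
  | top => exact le_top
  | coe y =>
    induction x with
    | top =>
      rw [show (((⊤ : ℝ≥0∞) : EReal) - ((M : ℝ≥0∞) : EReal)) = ⊤ from rfl] at hxy
      simp only [EReal.coe_nnreal_eq_coe_real, ← EReal.coe_sub, top_le_iff,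
        EReal.coe_ne_top] at hxy
    | coe x =>
      simp only [EReal.coe_nnreal_eq_coe_real, ← EReal.coe_sub, EReal.coe_le_coe_iff] at hxy
      have : (x : ℝ) ≤ y := by linarith
      exact_mod_cast this

theorem continuous_sdist {N : ℕ} (E : Set (EuclideanSpace ℝ (Fin N))) : Continuous (sdist E) :=
  (Metric.continuous_infDist_pt E).sub (Metric.continuous_infDist_pt Eᶜ)

theorem lintegral_ofReal_neg_sdist_div_ne_top {N : ℕ} {E : Set (EuclideanSpace ℝ (Fin N))}
    (hE : Bornology.IsBounded E) {h : ℝ} (hh : 0 < h) :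
    ∫⁻ x, ENNReal.ofReal (-(sdist E x / h)) ≠ ∞ := by
  obtain ⟨R, hR⟩ := hE.subset_closedBall 0
  have hint : IntegrableOn (fun x => -(sdist E x / h)) (Metric.closedBall 0 R) :=
    (((continuous_sdist E).div_const h).neg.continuousOn).integrableOn_compact
      (isCompact_closedBall _ _)
  have hsupp : (Function.support fun x => ENNReal.ofReal (-(sdist E x / h))) ⊆
      Metric.closedBall 0 R := by
    refine fun x hx => hR ?_
    by_contra hxE
    refine hx (ENNReal.ofReal_of_nonpos (neg_nonpos.2 (div_nonneg ?_ hh.le)))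
    rw [sdist, Metric.infDist_zero_of_mem (mem_compl hxE), sub_zero]
    exact Metric.infDist_nonneg
  rw [← setLIntegral_eq_of_support_subset hsupp]
  exact hint.lintegral_lt_top.ne

/-- The incremental energy shifted by the (finite) integral of the negative part of its density,
which makes it a sum of nonnegative terms. -/
noncomputable def shiftedEnergy {N : ℕ} (J : Set (EuclideanSpace ℝ (Fin N)) → ℝ≥0∞)
    (f : EuclideanSpace ℝ (Fin N) → ℝ) (F : Set (EuclideanSpace ℝ (Fin N))) : ℝ≥0∞ :=
  J F + ((∫⁻ x in F, ENNReal.ofReal (f x)) + ∫⁻ x in Fᶜ, ENNReal.ofReal (-f x))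

theorem eneSet_eq_shiftedEnergy_sub {N : ℕ} (J : Set (EuclideanSpace ℝ (Fin N)) → ℝ≥0∞)
    {E : Set (EuclideanSpace ℝ (Fin N))} (hE : Bornology.IsBounded E) {h : ℝ} (hh : 0 < h)
    {F : Set (EuclideanSpace ℝ (Fin N))} (hF : MeasurableSet F) :
    eneSet J E h F = (shiftedEnergy J (fun x => sdist E x / h) F : EReal) -
      ((∫⁻ x, ENNReal.ofReal (-(sdist E x / h)) : ℝ≥0∞) : EReal) :=
  ereal_add_sub_eq_sub (lintegral_ofReal_neg_sdist_div_ne_top hE hh)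
    (lintegral_add_compl _ hF)

theorem measurable_shiftedEnergy_superlevel {N : ℕ}
    {J : Set (EuclideanSpace ℝ (Fin N)) → ℝ≥0∞}
    {f u : EuclideanSpace ℝ (Fin N) → ℝ} (hf : Measurable f) (hu : Measurable u)
    (hJ : Measurable fun s : ℝ => J {x | s < u x}) :
    Measurable fun s : ℝ => shiftedEnergy J f {x | s < u x} := by
  have hlt : MeasurableSet {p : ℝ × EuclideanSpace ℝ (Fin N) | p.1 < u p.2} :=
    measurableSet_lt measurable_fst (hu.comp measurable_snd)
  exact hJ.add ((measurable_setLIntegral_section hlt hf.ennreal_ofReal).add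
    (measurable_setLIntegral_section hlt.compl hf.neg.ennreal_ofReal))

theorem eneFun_eq_lintegral_shiftedEnergy_sub {N : ℕ}
    {J : Set (EuclideanSpace ℝ (Fin N)) → ℝ≥0∞}
    {E : Set (EuclideanSpace ℝ (Fin N))} (hE : Bornology.IsBounded E) {h : ℝ} (hh : 0 < h)
    {u : EuclideanSpace ℝ (Fin N) → ℝ} (hu : Measurable u) (hu01 : ∀ x, u x ∈ Icc (0 : ℝ) 1)
    (hJ : Measurable fun s : ℝ => J {x | s < u x}) :
    eneFun J E h u =
      ((∫⁻ s in Ioo (0 : ℝ) 1, shiftedEnergy J (fun x => sdist E x / h) {x | s < u x} :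
        ℝ≥0∞) : EReal) - ((∫⁻ x, ENNReal.ofReal (-(sdist E x / h)) : ℝ≥0∞) : EReal) := by
  have hf : Measurable fun x => sdist E x / h := (continuous_sdist E).measurable.div_const h
  have hlt : MeasurableSet {p : ℝ × EuclideanSpace ℝ (Fin N) | p.1 < u p.2} :=
    measurableSet_lt measurable_fst (hu.comp measurable_snd)
  have hpos : ∫⁻ s in Ioo (0 : ℝ) 1, ∫⁻ x in {x | s < u x}, ENNReal.ofReal (sdist E x / h) =
      ∫⁻ x, ENNReal.ofReal (u x * sdist E x / h) := by
    refine (lintegral_setLIntegral_section hlt hf.ennreal_ofReal).trans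
      (lintegral_congr fun x => ?_)
    rw [mul_div_assoc, ENNReal.ofReal_mul (hu01 x).1]
    congr 1
    exact volume_setOf_lt_inter_Ioo (hu01 x)
  have hneg : ∫⁻ s in Ioo (0 : ℝ) 1,
      ∫⁻ x in {x | s < u x}ᶜ, ENNReal.ofReal (-(sdist E x / h)) =
      ∫⁻ x, ENNReal.ofReal (1 - u x) * ENNReal.ofReal (-(sdist E x / h)) := by
    refine (lintegral_setLIntegral_section hlt.compl hf.neg.ennreal_ofReal).trans
      (lintegral_congr fun x => ?_)
    congr 1
    rw [← volume_setOf_le_inter_Ioo (hu01 x)]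
    simp
  have hposmeas : Measurable fun s : ℝ =>
      ∫⁻ x in {x | s < u x}, ENNReal.ofReal (sdist E x / h) :=
    measurable_setLIntegral_section hlt hf.ennreal_ofReal
  simp only [shiftedEnergy]
  rw [lintegral_add_left hJ, lintegral_add_left hposmeas, hpos, hneg]
  refine (?_ : eneFun J E h u = _).trans (ereal_add_sub_eq_sub
    (lintegral_ofReal_neg_sdist_div_ne_top hE hh)
    (q := ∫⁻ x, ENNReal.ofReal (-(u x * sdist E x / h))) ?_)
  · simp only [eneFun, enInt, Measure.restrict_univ]
  · have hnegmeas : Measurable fun x => ENNReal.ofReal (-(u x * sdist E x / h)) :=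
      ((hu.mul (continuous_sdist E).measurable).div_const h).neg.ennreal_ofReal
    rw [← lintegral_add_left hnegmeas]
    refine lintegral_congr fun x => ?_
    rw [mul_div_assoc, ← mul_neg, ENNReal.ofReal_mul (hu01 x).1, ← add_mul,
      ← ENNReal.ofReal_add (hu01 x).1 (sub_nonneg.2 (hu01 x).2)]
    simp

theorem superlevel_indicator_one {X : Type*} (F : Set X) (s : ℝ) :
    {x | s < F.indicator (fun _ => (1 : ℝ)) x} =
      if s < 0 then univ else if s < 1 then F else ∅ := by
  ext x
  by_cases hx : x ∈ F <;> split_ifs <;> simp [hx] <;> linarith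

theorem measurable_superlevel_indicator {X : Type*} (J : Set X → ℝ≥0∞) (F : Set X) :
    Measurable fun s : ℝ => J {x | s < F.indicator (fun _ => (1 : ℝ)) x} := by
  simp only [superlevel_indicator_one, apply_ite J]
  exact measurable_const.ite measurableSet_Iio (measurable_const.ite measurableSet_Iio
    measurable_const)

theorem eneFun_indicator {N : ℕ} (J : Set (EuclideanSpace ℝ (Fin N)) → ℝ≥0∞)
    (E : Set (EuclideanSpace ℝ (Fin N))) (h : ℝ)
    {F : Set (EuclideanSpace ℝ (Fin N))} (hF : MeasurableSet F) :
    eneFun J E h (F.indicator fun _ => 1) = eneSet J E h F := by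
  have hJ : ∫⁻ s in Ioo (0 : ℝ) 1, J {x | s < F.indicator (fun _ => (1 : ℝ)) x} = J F := by
    rw [setLIntegral_congr_fun measurableSet_Ioo (g := fun _ => J F) fun s hs => by
      simp only [superlevel_indicator_one, if_neg hs.1.not_gt, if_pos hs.2]]
    simp
  rw [eneFun, eneSet, hJ, enInt, enInt, Measure.restrict_univ, ← lintegral_indicator hF,
    ← lintegral_indicator hF]
  congr 4 <;> ext x <;> by_cases hx : x ∈ F <;> simp [hx]

/-- If the `[0,1]`-valued function `u` minimizes the coarea extension
`𝓔̄` of the incremental energy among all measurable `[0,1]`-valued functions (with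
measurable level-set profile), then for a.e. `s ∈ (0,1)` the superlevel set `{u > s}`
minimizes the incremental energy `𝓔` among Lebesgue-measurable sets. -/
theorem stmt16 (N : ℕ) (hN : 1 ≤ N)
    (J : Set (EuclideanSpace ℝ (Fin N)) → ℝ≥0∞)
    (E : Set (EuclideanSpace ℝ (Fin N))) (hEne : E.Nonempty)
    (hEbd : Bornology.IsBounded E)
    (h : ℝ) (hh : 0 < h)
    (u : EuclideanSpace ℝ (Fin N) → ℝ) (humeas : Measurable u)
    (hurange : ∀ x, u x ∈ Set.Icc (0:ℝ) 1)
    (huprof : Measurable fun s : ℝ => J {x | s < u x})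
    (humin : ∀ v : EuclideanSpace ℝ (Fin N) → ℝ, Measurable v →
      (∀ x, v x ∈ Set.Icc (0:ℝ) 1) → (Measurable fun s : ℝ => J {x | s < v x}) →
      eneFun J E h u ≤ eneFun J E h v) :
    ∀ᵐ s ∂(volume : Measure ℝ), s ∈ Set.Ioo (0:ℝ) 1 →
      ∀ F : Set (EuclideanSpace ℝ (Fin N)), MeasurableSet F →
        eneSet J E h {x | s < u x} ≤ eneSet J E h F := by
  set G := shiftedEnergy J fun x => sdist E x / h
  have hf : Measurable fun x => sdist E x / h := (continuous_sdist E).measurable.div_const h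
  have hM := lintegral_ofReal_neg_sdist_div_ne_top hEbd hh
  have hlevel (s : ℝ) : MeasurableSet {x | s < u x} := measurableSet_lt measurable_const humeas
  have hle (F : Set (EuclideanSpace ℝ (Fin N))) (hF : MeasurableSet F) :
      ∫⁻ s in Ioo (0 : ℝ) 1, G {x | s < u x} ≤ G F := by
    have hmin := humin (F.indicator fun _ => 1) (measurable_const.indicator hF)
      (fun x => ⟨indicator_nonneg (fun _ _ => zero_le_one) x,
        indicator_le_self' (fun _ _ => zero_le_one) x⟩)
      (measurable_superlevel_indicator J F)
    rwa [eneFun_indicator J E h hF, eneSet_eq_shiftedEnergy_sub J hEbd hh hF,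
      eneFun_eq_lintegral_shiftedEnergy_sub hEbd hh humeas hurange huprof,
      ereal_sub_le_sub_iff hM] at hmin
  suffices hae : ∀ᵐ s ∂(volume.restrict (Ioo (0 : ℝ) 1)),
      G {x | s < u x} ≤ ∫⁻ s in Ioo (0 : ℝ) 1, G {x | s < u x} by
    filter_upwards [(ae_restrict_iff' measurableSet_Ioo).1 hae] with s hs hs01 F hF
    rw [eneSet_eq_shiftedEnergy_sub J hEbd hh (hlevel s),
      eneSet_eq_shiftedEnergy_sub J hEbd hh hF, ereal_sub_le_sub_iff hM]
    exact (hs hs01).trans (hle F hF)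
  by_cases htop : ∫⁻ s in Ioo (0 : ℝ) 1, G {x | s < u x} = ∞
  · simp [htop]
  have heq := ae_eq_of_ae_le_of_lintegral_le (μ := volume.restrict (Ioo (0 : ℝ) 1))
    (f := fun _ => ∫⁻ s in Ioo (0 : ℝ) 1, G {x | s < u x})
    (g := fun s => G {x | s < u x}) (ae_of_all _ fun s => hle _ (hlevel s))
    (by simpa using htop) (measurable_shiftedEnergy_superlevel hf humeas huprof).aemeasurable
    (by simp)
  exact heq.symm.le
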